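/- Let q ≡ 1 (mod 5), let ψ ∈ F_q^*, set λ = ψ^{−5}, and let χ be a multiplicative character of F_q^* of order 5. For a multiplicative character χ' of F_q^* set N(A_ψ,χ') = Σ_{x ∈ F_q, x ≠ 0, x ≠ 1, x ≠ 1/λ} χ'^2(x)·χ'^3(1−x)·χ'^{−3}(1−λx). Then N_{(0,0,0,1,4),χ}(q) = q·N(A_ψ,χ) and N_{(0,0,0,2,3),χ}(q) = q·N(A_ψ,χ^2). -/

import Mathlib

/-- The group of multiplicative characters of a finite field with values in `ℂ` is finite. -/
noncomputable instance {F : Type*} [Field F] [Fintype F] : Fintype (MulChar F ℂ) :=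
  Fintype.ofFinite _

/-- The Gauss sum `G(φ, χ) = ∑_{x ∈ F*} φ(x) χ(x)`. -/
noncomputable def gaussSum' {F : Type*} [Field F] [Fintype F]
    (φ : AddChar F ℂ) (χ : MulChar F ℂ) : ℂ :=
  letI := Classical.decEq F
  ∑ x : Fˣ, φ (x : F) * χ (x : F)

/-- `z` is the number of indices `j` such that `χ^{s_j} η` is trivial. -/
noncomputable def zNum {F : Type*} [Field F] [Fintype F]
    (χ η : MulChar F ℂ) (s : Fin 5 → ℤ) : ℕ :=
  letI := Classical.decEq (MulChar F ℂ)
  (Finset.univ.filter (fun j : Fin 5 => χ ^ s j * η = 1)).card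

/-- `δ = 0` if `z ≥ 1` and `δ = 1` if `z = 0`. -/
noncomputable def deltaNum {F : Type*} [Field F] [Fintype F]
    (χ η : MulChar F ℂ) (s : Fin 5 → ℤ) : ℕ :=
  if 1 ≤ zNum χ η s then 0 else 1

/-- `N_{(s₁,…,s₅),χ}(q) = (1/(q-1)) ∑_η q^{5-z-δ} G(φ,η⁵) / (∏_j G(φ,χ^{s_j} η)) η(1/(5ψ)⁵)`. -/
noncomputable def Ntuple {F : Type*} [Field F] [Fintype F]
    (φ : AddChar F ℂ) (χ : MulChar F ℂ) (ψ : F) (s : Fin 5 → ℤ) : ℂ :=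
  (1 / ((Fintype.card F : ℂ) - 1)) *
    ∑ η : MulChar F ℂ,
      (Fintype.card F : ℂ) ^ ((5 : ℤ) - zNum χ η s - deltaNum χ η s) *
        gaussSum' φ (η ^ 5) / (∏ j : Fin 5, gaussSum' φ (χ ^ s j * η)) *
        η ((((5 : F) * ψ) ^ 5)⁻¹)

/-- `N(A_ψ, χ') = ∑_{x ≠ 0, 1, 1/λ} χ'^{e₁}(x) χ'^{e₂}(1-x) χ'^{-e₂}(1-λx)`. -/
noncomputable def NcurvePsi {F : Type*} [Field F] [Fintype F] (e₁ e₂ : ℕ)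
    (lam : F) (χ' : MulChar F ℂ) : ℂ :=
  letI := Classical.decEq F
  ∑ x ∈ Finset.univ.filter (fun x : F => x ≠ 0 ∧ x ≠ 1 ∧ x ≠ lam⁻¹),
    (χ' ^ e₁) x * (χ' ^ e₂) (1 - x) * (χ' ^ (-(e₂ : ℤ))) (1 - lam * x)

section

open Polynomial

/-- The monic polynomial of degree `n` with lower coefficients `c`. -/
noncomputable def monicOfCoeffs {F : Type*} [Field F] {n : ℕ} (c : Fin n → F) : F[X] :=
  X ^ n + ∑ i, C (c i) * X ^ (i : ℕ)

section Monic

variable {F : Type*} [Field F]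

theorem degree_sum_coeffs_lt {n : ℕ} (c : Fin n → F) :
    (∑ i, C (c i) * X ^ (i : ℕ) : F[X]).degree < n :=
  degree_sum_fin_lt c

theorem monic_monicOfCoeffs {n : ℕ} (c : Fin n → F) : (monicOfCoeffs c).Monic :=
  monic_X_pow_add (degree_sum_coeffs_lt c)

theorem natDegree_monicOfCoeffs {n : ℕ} (c : Fin n → F) : (monicOfCoeffs c).natDegree = n := by
  rw [monicOfCoeffs, natDegree_add_eq_left_of_degree_lt] <;>
    simp [degree_sum_coeffs_lt]

theorem monicOfCoeffs_injective {n : ℕ} :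
    Function.Injective (monicOfCoeffs : (Fin n → F) → F[X]) := by
  intro c d h
  ext i
  have := congrArg (fun p => coeff p (i : ℕ)) h
  simpa [monicOfCoeffs, finsetSum_coeff, coeff_X_pow, i.2.ne, Fin.val_inj] using this

theorem exists_monicOfCoeffs_eq {g : F[X]} (hg : g.Monic) :
    ∃ c : Fin g.natDegree → F, monicOfCoeffs c = g := by
  refine ⟨fun i => g.coeff i, ?_⟩
  conv_rhs => rw [hg.as_sum]
  rw [monicOfCoeffs, Finset.sum_range]

theorem eval_monicOfCoeffs {n : ℕ} (c : Fin n → F) (a : F) :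
    (monicOfCoeffs c).eval a = a ^ n + ∑ i, c i * a ^ (i : ℕ) := by
  simp [monicOfCoeffs, eval_finsetSum]

variable [Fintype F]

/-- The sum of `f` over the monic polynomials of degree `n`. -/
noncomputable def monicSum (f : F[X] → ℂ) (n : ℕ) : ℂ :=
  ∑ c : Fin n → F, f (monicOfCoeffs c)

theorem monicSum_zero (f : F[X] →* ℂ) : monicSum f 0 = 1 := by
  simp [monicSum, monicOfCoeffs]

theorem sum_multiples_monicOfCoeffs (f : F[X] →* ℂ) {c : F[X]} (hc : c.Monic)
    {k n : ℕ} (hk : c.natDegree = k)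
    [DecidablePred fun d : Fin (k + n) → F => c ∣ monicOfCoeffs d] :
    ∑ d : Fin (k + n) → F, (if c ∣ monicOfCoeffs d then f (monicOfCoeffs d) else 0) =
      f c * monicSum f n := by
  subst hk
  rw [monicSum, Finset.mul_sum, ← Finset.sum_filter]
  symm
  have key (d : Fin n → F) : ∃ e : Fin (c.natDegree + n) → F,
      monicOfCoeffs e = c * monicOfCoeffs d := by
    have h1 := hc.mul (monic_monicOfCoeffs d)
    have h2 : (c * monicOfCoeffs d).natDegree = c.natDegree + n := by
      rw [hc.natDegree_mul (monic_monicOfCoeffs d), natDegree_monicOfCoeffs]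
    rw [← h2]
    exact exists_monicOfCoeffs_eq h1
  choose e he using key
  refine Finset.sum_bij (fun d _ => e d) ?_ ?_ ?_ ?_
  · intro d _
    simp [he]
  · intro d _ d' _ h
    have := congrArg monicOfCoeffs h
    rw [he, he] at this
    exact monicOfCoeffs_injective (mul_left_cancel₀ hc.ne_zero this)
  · intro b hb
    obtain ⟨h, hh⟩ := (Finset.mem_filter.1 hb).2
    have hm : h.Monic := hc.of_mul_monic_left (hh ▸ monic_monicOfCoeffs b)
    have hdeg : h.natDegree = n := by
      have := natDegree_monicOfCoeffs b
      rw [hh, hc.natDegree_mul hm] at this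
      omega
    obtain ⟨d, hd⟩ : ∃ d : Fin n → F, monicOfCoeffs d = h := by
      rw [← hdeg]; exact exists_monicOfCoeffs_eq hm
    exact ⟨d, Finset.mem_univ _, monicOfCoeffs_injective (by rw [he, hd, hh])⟩
  · intro d _
    rw [he, map_mul]

end Monic

/-- The characteristic polynomial of `x`, as a power of its minimal polynomial. -/
noncomputable def minpolyPow (F : Type*) {E : Type*} [Field F] [Field E] [Algebra F E] (x : E) :
    F[X] :=
  minpoly F x ^ (Module.finrank F E / (minpoly F x).natDegree)

section MinpolyPow

variable {F E : Type*} [Field F] [Field E] [Algebra F E] [FiniteDimensional F E]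

theorem natDegree_minpoly_dvd_finrank (x : E) :
    (minpoly F x).natDegree ∣ Module.finrank F E :=
  minpoly.degree_dvd (Algebra.IsIntegral.isIntegral x)

theorem monic_minpolyPow (x : E) : (minpolyPow F x).Monic :=
  (minpoly.monic (Algebra.IsIntegral.isIntegral x)).pow _

theorem natDegree_minpolyPow (x : E) : (minpolyPow F x).natDegree = Module.finrank F E := by
  rw [minpolyPow, natDegree_pow, Nat.div_mul_cancel (natDegree_minpoly_dvd_finrank x)]

open IntermediateField in
theorem eval_minpolyPow (x : E) (a : F) :
    (minpolyPow F x).eval a = Algebra.norm F (algebraMap F E a - x) := by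
  have hx : IsIntegral F x := Algebra.IsIntegral.isIntegral x
  have h1 : algebraMap F E a - x =
      algebraMap F⟮x⟯ E (algebraMap F F⟮x⟯ a - AdjoinSimple.gen F x) := by
    rw [map_sub, ← IsScalarTower.algebraMap_apply, AdjoinSimple.algebraMap_gen]
  have h2 : Algebra.norm F (algebraMap F F⟮x⟯ a - AdjoinSimple.gen F x) = (minpoly F x).eval a := by
    have := charpoly_leftMulMatrix (adjoin.powerBasis hx)
    rw [adjoin.powerBasis_gen, minpoly_gen] at this
    rw [← this, Matrix.eval_charpoly, Algebra.norm_eq_matrix_det (adjoin.powerBasis hx).basis,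
      map_sub, AlgHom.commutes]
    rfl
  rw [h1, ← Algebra.norm_norm (S := F⟮x⟯), Algebra.norm_algebraMap, map_pow, h2, minpolyPow,
    eval_pow, ← adjoin.finrank hx, ← Module.finrank_mul_finrank F F⟮x⟯ E,
    Nat.mul_div_cancel_left _ Module.finrank_pos]

end MinpolyPow

section Count

variable {F : Type*} [Field F]

open UniqueFactorizationMonoid in
theorem card_pow_dvd_eq_count [DecidableEq F] [DecidableEq F[X]] {g P : F[X]} (hg : g ≠ 0)
    (hP : Irreducible P) (hm : P.Monic) {n : ℕ} (hn : g.natDegree ≤ n)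
    [DecidablePred fun k => P.natDegree ∣ k + 1 ∧ P ^ ((k + 1) / P.natDegree) ∣ g] :
    ((Finset.range n).filter fun k => P.natDegree ∣ k + 1 ∧
      P ^ ((k + 1) / P.natDegree) ∣ g).card = (normalizedFactors g).count P := by
  have hdvd (r : ℕ) : P ^ r ∣ g ↔ r ≤ (normalizedFactors g).count P := by
    rw [pow_dvd_iff_le_emultiplicity, emultiplicity_eq_count_normalizedFactors hP hg,
      hm.normalize_eq_self, Nat.cast_le]
  have hd := hP.natDegree_pos
  rw [← Finset.card_range ((normalizedFactors g).count P)]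
  symm
  refine Finset.card_bij (fun r _ => (r + 1) * P.natDegree - 1) ?_ ?_ ?_
  · intro r hr
    have hpos : 0 < (r + 1) * P.natDegree := by positivity
    have hdv : P ^ (r + 1) ∣ g := (hdvd _).2 (Finset.mem_range.1 hr)
    have hle := (natDegree_le_of_dvd hdv hg).trans hn
    rw [natDegree_pow] at hle
    rw [Finset.mem_filter, Finset.mem_range, Nat.sub_add_cancel hpos]
    refine ⟨by omega, dvd_mul_left _ _, ?_⟩
    rwa [Nat.mul_div_cancel _ hd]
  · intro r _ s _ h
    have h1 : 0 < (r + 1) * P.natDegree := by positivity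
    have h2 : 0 < (s + 1) * P.natDegree := by positivity
    have h3 : (r + 1) * P.natDegree = (s + 1) * P.natDegree := by omega
    have := Nat.eq_of_mul_eq_mul_right hd h3
    omega
  · intro k hk
    obtain ⟨-, ⟨r, hr⟩, hk⟩ := Finset.mem_filter.1 hk
    rw [hr, Nat.mul_div_cancel_left _ hd, hdvd] at hk
    have hr0 : 0 < r := by
      rcases Nat.eq_zero_or_pos r with rfl | h
      · simp at hr
      · exact h
    refine ⟨r - 1, Finset.mem_range.2 (by omega), ?_⟩
    rw [Nat.sub_add_cancel hr0, mul_comm, ← hr, Nat.add_sub_cancel]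

variable [Fintype F]

theorem card_minpoly_eq {E : Type*} [Field E] [Fintype E] [Algebra F E] {P : F[X]}
    (hP : Irreducible P) (hm : P.Monic) [DecidablePred fun x : E => minpoly F x = P] :
    (Finset.univ.filter fun x : E => minpoly F x = P).card =
      if P.natDegree ∣ Module.finrank F E then P.natDegree else 0 := by
  classical
  split_ifs with h
  · rw [hP.natDegree_dvd_iff_dvd_X_pow_card_pow_sub_X, ← Module.natCard_eq_pow_finrank,
      Nat.card_eq_fintype_card] at h
    have hsplit : ((X ^ Fintype.card E - X : F[X]).map (algebraMap F E)).Splits :=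
      (FiniteField.isSplittingField_sub E F).splits
    have hne : (X ^ Fintype.card E - X : F[X]) ≠ 0 :=
      FiniteField.X_pow_card_sub_X_ne_zero F Fintype.one_lt_card
    have hs : (P.map (algebraMap F E)).Splits :=
      hsplit.of_dvd (map_ne_zero hne) (Polynomial.map_dvd _ h)
    have hsep : (P.map (algebraMap F E)).Separable :=
      (PerfectField.separable_of_irreducible hP).map
    have hcard := hs.natDegree_eq_card_roots
    rw [natDegree_map] at hcard
    rw [hcard, ← Multiset.toFinset_card_of_nodup (nodup_roots hsep)]
    congr 1
    ext x
    simp only [Finset.mem_filter, Finset.mem_univ, true_and, Multiset.mem_toFinset,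
      mem_roots (map_ne_zero (f := algebraMap F E) hP.ne_zero), IsRoot.def, eval_map_algebraMap]
    refine ⟨fun hx => hx ▸ minpoly.aeval F x, fun hx => ?_⟩
    exact (minpoly.eq_of_irreducible_of_monic hP hx hm).symm
  · rw [Finset.card_eq_zero, Finset.filter_eq_empty_iff]
    rintro x - rfl
    exact h (natDegree_minpoly_dvd_finrank x)

variable {E : ℕ → Type*} [∀ k, Field (E k)] [∀ k, Fintype (E k)] [∀ k, Algebra F (E k)]

open UniqueFactorizationMonoid in
theorem sum_card_minpolyPow_dvd (hE : ∀ k, Module.finrank F (E k) = k + 1) {g : F[X]}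
    (hg : g.Monic) [∀ k, DecidablePred fun x : E k => minpolyPow F x ∣ g] :
    ∑ k ∈ Finset.range g.natDegree,
      (Finset.univ.filter fun x : E k => minpolyPow F x ∣ g).card = g.natDegree := by
  classical
  have hprime {P : F[X]} (hP : P ∈ (normalizedFactors g).toFinset) : Irreducible P ∧ P.Monic := by
    rw [Multiset.mem_toFinset] at hP
    have h := irreducible_of_normalized_factor P hP
    refine ⟨h, ?_⟩
    have := normalize_normalized_factor P hP
    rw [← this]
    exact monic_normalize h.ne_zero
  have hcount (k : ℕ) : (Finset.univ.filter fun x : E k => minpolyPow F x ∣ g).card =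
      ∑ P ∈ (normalizedFactors g).toFinset,
        if P.natDegree ∣ k + 1 ∧ P ^ ((k + 1) / P.natDegree) ∣ g then P.natDegree else 0 := by
    rw [Finset.card_eq_sum_card_fiberwise (f := fun x => minpoly F x)
      (t := (normalizedFactors g).toFinset)]
    · refine Finset.sum_congr rfl fun P hP => ?_
      obtain ⟨hi, hm⟩ := hprime hP
      by_cases hd : P ^ ((k + 1) / P.natDegree) ∣ g
      · have := card_minpoly_eq (E := E k) hi hm
        rw [hE] at this
        simp only [hd, and_true]
        rw [← this]
        congr 1
        ext x
        simp only [Finset.mem_filter, Finset.mem_univ, true_and, and_iff_right_iff_imp]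
        rintro rfl
        rw [minpolyPow, hE]
        exact hd
      · simp only [hd, and_false, if_false, Finset.card_eq_zero, Finset.filter_eq_empty_iff]
        intro x hx hx'
        rw [Finset.mem_filter, minpolyPow, hE, hx'] at hx
        exact hd hx.2
    · intro x hx
      have hdv := (Finset.mem_filter.1 hx).2
      have hint : IsIntegral F x := Algebra.IsIntegral.isIntegral x
      have hne : Module.finrank F (E k) / (minpoly F x).natDegree ≠ 0 := by
        have := Nat.div_pos (Nat.le_of_dvd Module.finrank_pos (natDegree_minpoly_dvd_finrank x))
          (minpoly.natDegree_pos hint)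
        exact this.ne'
      have hdv' : minpoly F x ∣ g := (dvd_pow_self _ hne).trans hdv
      rw [Finset.mem_coe, Multiset.mem_toFinset]
      obtain ⟨q, hq, hass⟩ := exists_mem_normalizedFactors_of_dvd hg.ne_zero
        (minpoly.irreducible hint) hdv'
      have := (hprime (Multiset.mem_toFinset.2 hq)).2
      beta_reduce
      rwa [eq_of_monic_of_associated (minpoly.monic hint) this hass]
  simp only [hcount]
  rw [Finset.sum_comm]
  have hstep : ∀ P ∈ (normalizedFactors g).toFinset, ∑ k ∈ Finset.range g.natDegree,
      (if P.natDegree ∣ k + 1 ∧ P ^ ((k + 1) / P.natDegree) ∣ g then P.natDegree else 0) =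
      (normalizedFactors g).count P * P.natDegree := by
    intro P hP
    obtain ⟨hi, hm⟩ := hprime hP
    rw [← Finset.sum_filter, Finset.sum_const, card_pow_dvd_eq_count hg.ne_zero hi hm le_rfl,
      smul_eq_mul]
  rw [Finset.sum_congr rfl hstep]
  have hprod : (normalizedFactors g).prod = g := by
    refine eq_of_monic_of_associated ?_ hg (prod_normalizedFactors hg.ne_zero)
    simpa using monic_multiset_prod_of_monic (normalizedFactors g) id
      fun P hP => (hprime (Multiset.mem_toFinset.2 hP)).2
  conv_rhs => rw [← hprod]
  rw [natDegree_multiset_prod_of_monic _ fun P hP => (hprime (Multiset.mem_toFinset.2 hP)).2,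
    Finset.sum_multiset_map_count]
  rfl

/-- The sum over all `x` in `E` of `f` at the characteristic polynomial of `x`. -/
noncomputable def powerSum (E : Type*) [Field E] [Fintype E] [Algebra F E] (f : F[X] → ℂ) : ℂ :=
  ∑ x : E, f (minpolyPow F x)

theorem natCast_mul_monicSum (hE : ∀ k, Module.finrank F (E k) = k + 1) (f : F[X] →* ℂ) (n : ℕ) :
    (n : ℂ) * monicSum f n =
      ∑ k ∈ Finset.range n, powerSum (E k) f * monicSum f (n - (k + 1)) := by
  classical
  have h (c : Fin n → F) : (n : ℂ) * f (monicOfCoeffs c) =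
      ∑ k ∈ Finset.range n, ∑ x : E k,
        if minpolyPow F x ∣ monicOfCoeffs c then f (monicOfCoeffs c) else 0 := by
    have := sum_card_minpolyPow_dvd hE (monic_monicOfCoeffs c)
    rw [natDegree_monicOfCoeffs] at this
    simp only [← Finset.sum_filter, Finset.sum_const, nsmul_eq_mul]
    rw [← Finset.sum_mul]
    congr 1
    exact_mod_cast this.symm
  rw [monicSum, Finset.mul_sum, Finset.sum_congr rfl fun c _ => h c, Finset.sum_comm]
  refine Finset.sum_congr rfl fun k hk => ?_
  rw [Finset.sum_comm, powerSum, Finset.sum_mul]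
  refine Finset.sum_congr rfl fun x _ => ?_
  obtain ⟨l, rfl⟩ := Nat.exists_eq_add_of_le (Nat.succ_le_of_lt (Finset.mem_range.1 hk))
  rw [Nat.succ_eq_add_one, Nat.add_sub_cancel_left]
  exact sum_multiples_monicOfCoeffs f (monic_minpolyPow x) ((natDegree_minpolyPow x).trans (hE k))

end Count

section LSeries

variable {F : Type*} [Field F] [Fintype F]

theorem PowerSeries.eq_of_derivative_eq_mul {R : Type*} [Field R] [CharZero R]
    {s a b : PowerSeries R} (ha : derivative R a = s * a) (hb : derivative R b = s * b)
    (h0 : constantCoeff a = constantCoeff b) : a = b := by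
  ext n
  induction n using Nat.strong_induction_on with
  | _ n ih =>
    rcases n with - | n
    · simpa using h0
    · have h1 := congrArg (coeff n) ha
      have h2 := congrArg (coeff n) hb
      rw [coeff_derivative, coeff_mul] at h1 h2
      have h3 : ∑ p ∈ Finset.HasAntidiagonal.antidiagonal n, coeff p.1 s * coeff p.2 a =
          ∑ p ∈ Finset.HasAntidiagonal.antidiagonal n, coeff p.1 s * coeff p.2 b := by
        refine Finset.sum_congr rfl fun p hp => ?_
        rw [ih p.2 (by have := Finset.HasAntidiagonal.mem_antidiagonal.1 hp; omega)]
      have hn : (n : R) + 1 ≠ 0 := by exact_mod_cast n.succ_ne_zero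
      exact mul_right_cancel₀ hn (by rw [h1, h2, h3])

theorem PowerSeries.derivative_prod_eq_sum_mul {R ι : Type*} [CommRing R] (s : Finset ι)
    {σ a : ι → PowerSeries R} (h : ∀ i ∈ s, derivative R (a i) = σ i * a i) :
    derivative R (∏ i ∈ s, a i) = (∑ i ∈ s, σ i) * ∏ i ∈ s, a i := by
  classical
  induction s using Finset.induction_on with
  | empty => simp
  | insert i s hi ih =>
    rw [Finset.prod_insert hi, Finset.sum_insert hi, Derivation.leibniz,
      ih fun j hj => h j (Finset.mem_insert_of_mem hj), h i (Finset.mem_insert_self i s),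
      smul_eq_mul, smul_eq_mul]
    ring

/-- The `L`-series `∑ f(g) X ^ deg g` over the monic polynomials `g`. -/
noncomputable def polyLSeries (f : F[X] → ℂ) : PowerSeries ℂ :=
  PowerSeries.mk (monicSum f)

variable {E : ℕ → Type*} [∀ k, Field (E k)] [∀ k, Fintype (E k)] [∀ k, Algebra F (E k)]

theorem derivative_polyLSeries (hE : ∀ k, Module.finrank F (E k) = k + 1) (f : F[X] →* ℂ) :
    PowerSeries.derivative ℂ (polyLSeries f) =
      PowerSeries.mk (fun k => powerSum (E k) f) * polyLSeries f := by
  ext n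
  rw [PowerSeries.coeff_derivative, PowerSeries.coeff_mul,
    Finset.Nat.sum_antidiagonal_eq_sum_range_succ_mk, polyLSeries]
  simp only [PowerSeries.coeff_mk]
  have := natCast_mul_monicSum hE f (n + 1)
  push_cast at this
  rw [mul_comm, this]

theorem polyLSeries_eq_prod (hE : ∀ k, Module.finrank F (E k) = k + 1) {ι : Type*}
    (s : Finset ι) (f : F[X] →* ℂ) (f' : ι → F[X] →* ℂ)
    (h : ∀ k, powerSum (E k) f = ∑ i ∈ s, powerSum (E k) (f' i)) :
    polyLSeries f = ∏ i ∈ s, polyLSeries (f' i) := by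
  refine PowerSeries.eq_of_derivative_eq_mul (derivative_polyLSeries hE f) ?_ ?_
  · have hs : PowerSeries.mk (fun k => powerSum (E k) f) =
        ∑ i ∈ s, PowerSeries.mk (fun k => powerSum (E k) (f' i)) := by
      ext k
      simp [h]
    rw [hs]
    exact PowerSeries.derivative_prod_eq_sum_mul s fun i _ => derivative_polyLSeries hE (f' i)
  · rw [map_prod]
    simp [polyLSeries, monicSum_zero]

theorem monicSum_card_eq_prod (hE : ∀ k, Module.finrank F (E k) = k + 1) {ι : Type*}
    (s : Finset ι) (f : F[X] →* ℂ) (f' : ι → F[X] →* ℂ)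
    (h : ∀ k, powerSum (E k) f = ∑ i ∈ s, powerSum (E k) (f' i))
    (h' : ∀ i ∈ s, ∀ n, 2 ≤ n → monicSum (f' i) n = 0) :
    monicSum f s.card = ∏ i ∈ s, monicSum (f' i) 1 := by
  have hlin : ∀ i ∈ s, polyLSeries (f' i) =
      ((1 + C (monicSum (f' i) 1) * X : ℂ[X]) : PowerSeries ℂ) := by
    intro i hi
    ext n
    rw [polyLSeries, PowerSeries.coeff_mk, coeff_coe]
    rcases n with - | - | n
    · simp [monicSum_zero]
    · simp [coeff_one]
    · rw [h' i hi _ (by omega)]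
      simp [coeff_one]
  have hL := polyLSeries_eq_prod hE s f f' h
  have hcoe := map_prod (coeToPowerSeries.ringHom (R := ℂ))
    (fun i => 1 + C (monicSum (f' i) 1) * X) s
  simp only [coeToPowerSeries.ringHom_apply] at hcoe
  rw [Finset.prod_congr rfl hlin, ← hcoe] at hL
  have hc := congrArg (PowerSeries.coeff s.card) hL
  rw [polyLSeries, PowerSeries.coeff_mk, coeff_coe] at hc
  have hdeg (i : ι) : (1 + C (monicSum (f' i) 1) * X : ℂ[X]).natDegree ≤ 1 := by
    compute_degree
  have := coeff_prod_of_natDegree_le s (fun i => (1 + C (monicSum (f' i) 1) * X : ℂ[X])) 1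
    fun i _ => hdeg i
  rw [mul_one] at this
  rw [hc, this]
  simp [coeff_one]

end LSeries

section PowerMap

theorem geom_sum_eq_zero_of_pow_eq_one {R : Type*} [Field R] {w : R} {m : ℕ} (hw : w ^ m = 1)
    (h : w ≠ 1) : ∑ j ∈ Finset.range m, w ^ j = 0 := by
  rw [geom_sum_eq h, hw, sub_self, zero_div]

variable {F E : Type*} [Field F] [Field E] [Fintype E] [Algebra F E]

theorem sum_mulChar_norm_eq_zero {η : MulChar F ℂ} (hη : η ≠ 1) :
    ∑ x : E, η (Algebra.norm F x) = 0 := by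
  obtain ⟨a, ha⟩ := MulChar.ne_one_iff.1 hη
  obtain ⟨z, hz⟩ := FiniteField.norm_surjective F E a
  have hz0 : z ≠ 0 := by
    rintro rfl
    rw [Algebra.norm_zero] at hz
    exact a.ne_zero hz.symm
  refine eq_zero_of_mul_eq_self_left ha ?_
  rw [Finset.mul_sum, ← hz]
  simp only [← map_mul]
  exact Equiv.sum_comp (Equiv.mulLeft₀ z hz0) fun x => η (Algebra.norm F x)

theorem card_pow_eq [DecidableEq E] {n : ℕ} {ζ : F} (hζ : IsPrimitiveRoot ζ (n + 1))
    {χ : MulChar F ℂ} (hχ : orderOf χ = n + 1) (y : E) :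
    ((Finset.univ.filter fun x : E => x ^ (n + 1) = y).card : ℂ) =
      1 + ∑ j ∈ Finset.range n, (χ ^ (j + 1)) (Algebra.norm F y) := by
  by_cases hy : y = 0
  · subst hy
    have : (Finset.univ.filter fun x : E => x ^ (n + 1) = 0) = {0} := by
      ext x
      simp
    rw [this, Algebra.norm_zero]
    simp [MulChar.map_zero]
  have hN : IsUnit (Algebra.norm F y) := (Algebra.norm_ne_zero_iff.2 hy).isUnit
  set w := χ (Algebra.norm F y) with hw
  have hsum : 1 + ∑ j ∈ Finset.range n, (χ ^ (j + 1)) (Algebra.norm F y) =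
      ∑ j ∈ Finset.range (n + 1), w ^ j := by
    rw [Finset.sum_range_succ', pow_zero, add_comm]
    congr 1
    refine Finset.sum_congr rfl fun j _ => ?_
    rw [MulChar.pow_apply' _ j.succ_ne_zero]
  have hχpow (a : F) (ha : a ≠ 0) : χ a ^ (n + 1) = 1 := by
    have h : χ ^ (n + 1) = 1 := hχ ▸ pow_orderOf_eq_one χ
    rw [← MulChar.pow_apply' _ (Nat.succ_ne_zero n), h, MulChar.one_apply ha.isUnit]
  rw [hsum]
  have hζE : IsPrimitiveRoot (algebraMap F E ζ) (n + 1) :=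
    hζ.map_of_injective (algebraMap F E).injective
  by_cases hex : ∃ x : E, x ^ (n + 1) = y
  · obtain ⟨x, rfl⟩ := hex
    have hx : x ≠ 0 := by
      rintro rfl
      simp at hy
    have hw1 : w = 1 := by
      rw [hw, map_pow, map_pow, hχpow _ (Algebra.norm_ne_zero_iff.2 hx)]
    have hset : (Finset.univ.filter fun z : E => z ^ (n + 1) = x ^ (n + 1)) =
        (nthRoots (n + 1) (x ^ (n + 1))).toFinset := by
      ext z
      simp [mem_nthRoots]
    rw [hset, Multiset.toFinset_card_of_nodup (hζE.nthRoots_nodup (pow_ne_zero _ hx)),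
      hζE.card_nthRoots, if_pos ⟨x, rfl⟩, hw1]
    simp
  · rw [Finset.filter_false_of_mem fun x _ h => hex ⟨x, h⟩, Finset.card_empty, Nat.cast_zero,
      geom_sum_eq_zero_of_pow_eq_one (hχpow _ hN.ne_zero)]
    intro hw1
    obtain ⟨γ, hγ⟩ := IsCyclic.exists_generator (α := Eˣ)
    obtain ⟨a, ha⟩ := mem_powers_iff_mem_zpowers.2 (hγ (Units.mk0 y hy))
    have ha' : (γ : E) ^ a = y := by
      simpa using congrArg Units.val ha
    have hord : n + 1 ∣ a := by
      rw [← hχ, orderOf_dvd_iff_pow_eq_one]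
      refine MulChar.ext fun b => ?_
      obtain ⟨z, hz⟩ := FiniteField.norm_surjective F E b
      have hz0 : z ≠ 0 := by
        rintro rfl
        rw [Algebra.norm_zero] at hz
        exact b.ne_zero hz.symm
      obtain ⟨c, hc⟩ := mem_powers_iff_mem_zpowers.2 (hγ (Units.mk0 z hz0))
      have hc' : (γ : E) ^ c = z := by
        simpa using congrArg Units.val hc
      have hγa : χ (Algebra.norm F (γ : E)) ^ a = 1 := by
        rw [← map_pow, ← map_pow, ha', hw1]
      rw [MulChar.pow_apply_coe, MulChar.one_apply_coe, ← hz, ← hc', map_pow, map_pow, ← pow_mul,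
        mul_comm, pow_mul, hγa, one_pow]
    obtain ⟨b, rfl⟩ := hord
    exact hex ⟨(γ : E) ^ b, by rw [← pow_mul, mul_comm, ha']⟩

theorem sum_mulChar_norm_one_sub_pow {n : ℕ} {ζ : F} (hζ : IsPrimitiveRoot ζ (n + 1))
    {χ : MulChar F ℂ} (hχ : orderOf χ = n + 1) {η : MulChar F ℂ} (hη : η ≠ 1) :
    ∑ x : E, η (Algebra.norm F (1 - x ^ (n + 1))) =
      ∑ j ∈ Finset.range n, ∑ y : E,
        η (Algebra.norm F (1 - y)) * (χ ^ (j + 1)) (Algebra.norm F y) := by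
  classical
  have hfib := Finset.sum_fiberwise (Finset.univ : Finset E) (fun x => x ^ (n + 1))
    fun x => η (Algebra.norm F (1 - x ^ (n + 1)))
  rw [← hfib, Finset.sum_comm]
  have h0 : ∑ y : E, η (Algebra.norm F (1 - y)) = 0 := by
    rw [← sum_mulChar_norm_eq_zero (E := E) hη]
    exact (Equiv.subLeft (1 : E)).sum_comp fun x => η (Algebra.norm F x)
  rw [← zero_add (∑ y : E, ∑ j ∈ Finset.range n, _), ← h0, ← Finset.sum_add_distrib]
  refine Finset.sum_congr rfl fun y _ => ?_
  rw [Finset.sum_congr rfl (g := fun _ => η (Algebra.norm F (1 - y)))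
    fun x hx => by rw [(Finset.mem_filter.1 hx).2], Finset.sum_const, nsmul_eq_mul]
  have h := card_pow_eq hζ hχ y
  rw [h, add_mul, one_mul, Finset.sum_mul]
  simp only [mul_comm]

end PowerMap

section JacobiProduct

variable {F : Type*} [Field F]

theorem MulChar.map_neg_one_eq_one_of_odd_pow {χ : MulChar F ℂ} {m : ℕ} (hm : Odd m)
    (hχ : χ ^ m = 1) : χ (-1) = 1 := by
  have h : χ (-1) ^ m = 1 := by
    rw [← MulChar.pow_apply' _ hm.pos.ne', hχ, MulChar.one_apply isUnit_one.neg]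
  rwa [← map_pow, hm.neg_one_pow] at h

/-- The multiplicative function `g ↦ η(g(1)) χ(g(0))`. -/
noncomputable def evalChar (η χ : MulChar F ℂ) : F[X] →* ℂ :=
  (η.toMonoidHom.comp (evalRingHom (1 : F)).toMonoidHom) *
    (χ.toMonoidHom.comp (evalRingHom (0 : F)).toMonoidHom)

theorem evalChar_apply (η χ : MulChar F ℂ) (g : F[X]) :
    evalChar η χ g = η (g.eval 1) * χ (g.eval 0) := rfl

/-- The multiplicative function `g ↦ ∏ᵢ η(g(ζ ^ i))`. -/
noncomputable def evalRootsChar (η : MulChar F ℂ) (ζ : F) (m : ℕ) : F[X] →* ℂ :=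
  ∏ i : Fin m, η.toMonoidHom.comp (evalRingHom (ζ ^ (i : ℕ))).toMonoidHom

theorem evalRootsChar_apply (η : MulChar F ℂ) (ζ : F) (m : ℕ) (g : F[X]) :
    evalRootsChar η ζ m g = ∏ i : Fin m, η (g.eval (ζ ^ (i : ℕ))) := by
  rw [evalRootsChar, MonoidHom.finsetProd_apply]
  rfl

theorem powerSum_evalChar {E : Type*} [Field E] [Fintype E] [Algebra F E] (η : MulChar F ℂ)
    {χ : MulChar F ℂ} (hχ : χ (-1) = 1) : powerSum E (evalChar η χ) =
      ∑ y : E, η (Algebra.norm F (1 - y)) * χ (Algebra.norm F y) := by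
  refine Finset.sum_congr rfl fun y _ => ?_
  have h : χ (Algebra.norm F (-y)) = χ (Algebra.norm F y) := by
    have : (-1 : E) = algebraMap F E (-1) := by simp
    rw [neg_eq_neg_one_mul, map_mul, map_mul, this, Algebra.norm_algebraMap, map_pow, hχ, one_pow,
      one_mul]
  rw [evalChar_apply, eval_minpolyPow, eval_minpolyPow, map_one, map_zero, zero_sub, h]

theorem prod_pow_sub_eq {R : Type*} [CommRing R] [IsDomain R] {ζ : R} {m : ℕ} (hm : Odd m)
    (hζ : IsPrimitiveRoot ζ m) (x : R) : ∏ i : Fin m, (ζ ^ (i : ℕ) - x) = 1 - x ^ m := by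
  have hX := congrArg (eval x) (X_pow_sub_one_eq_prod hm.pos hζ)
  simp only [eval_sub, eval_pow, eval_X, eval_one, eval_prod, eval_C] at hX
  have hbij : ∏ i : Fin m, (x - ζ ^ (i : ℕ)) = ∏ w ∈ nthRootsFinset m (1 : R), (x - w) := by
    refine Finset.prod_bij (fun i _ => ζ ^ (i : ℕ)) ?_ ?_ ?_ fun _ _ => rfl
    · intro i _
      rw [mem_nthRootsFinset hm.pos, ← pow_mul, mul_comm, pow_mul, hζ.pow_eq_one, one_pow]
    · intro i _ j _ h
      exact Fin.ext (hζ.pow_inj i.2 j.2 h)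
    · intro w hw
      have : NeZero m := ⟨hm.pos.ne'⟩
      obtain ⟨i, hi, rfl⟩ := hζ.eq_pow_of_pow_eq_one ((mem_nthRootsFinset hm.pos _).1 hw)
      exact ⟨⟨i, hi⟩, Finset.mem_univ _, rfl⟩
  calc ∏ i : Fin m, (ζ ^ (i : ℕ) - x) = ∏ i : Fin m, -(x - ζ ^ (i : ℕ)) := by simp only [neg_sub]
    _ = 1 - x ^ m := by
      rw [Finset.prod_neg, Finset.card_univ, Fintype.card_fin, hm.neg_one_pow, hbij, ← hX]
      ring

theorem powerSum_evalRootsChar {E : Type*} [Field E] [Fintype E] [Algebra F E] (η : MulChar F ℂ)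
    {ζ : F} {m : ℕ} (hm : Odd m) (hζ : IsPrimitiveRoot ζ m) :
    powerSum E (evalRootsChar η ζ m) = ∑ x : E, η (Algebra.norm F (1 - x ^ m)) := by
  refine Finset.sum_congr rfl fun x _ => ?_
  rw [evalRootsChar_apply, ← map_prod]
  simp only [eval_minpolyPow]
  rw [← map_prod]
  simp only [map_pow]
  rw [prod_pow_sub_eq hm (hζ.map_of_injective (algebraMap F E).injective)]

variable [Fintype F]

theorem monicSum_evalChar_one {η χ : MulChar F ℂ} (hχ : χ (-1) = 1) :
    monicSum (evalChar η χ) 1 = jacobiSum χ η := by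
  rw [monicSum, jacobiSum, ← (Equiv.funUnique (Fin 1) F).symm.sum_comp,
    ← Equiv.sum_comp (Equiv.neg F)]
  refine Finset.sum_congr rfl fun c _ => ?_
  rw [evalChar_apply, eval_monicOfCoeffs, eval_monicOfCoeffs]
  simp only [Equiv.neg_apply, Equiv.funUnique_symm_apply, uniqueElim_const, Finset.univ_unique,
    Finset.sum_singleton, Fin.default_eq_zero, Fin.val_zero, pow_zero, mul_one, one_pow, pow_one,
    zero_add]
  rw [neg_eq_neg_one_mul, map_mul, hχ, one_mul, ← neg_eq_neg_one_mul, ← sub_eq_add_neg, mul_comm]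

theorem monicSum_evalChar_eq_zero {η : MulChar F ℂ} (hη : η ≠ 1) (χ : MulChar F ℂ) {n : ℕ}
    (hn : 2 ≤ n) : monicSum (evalChar η χ) n = 0 := by
  obtain ⟨n, rfl⟩ := Nat.exists_eq_add_of_le' hn
  simp only [monicSum, evalChar_apply, eval_monicOfCoeffs]
  rw [← (Fin.insertNthEquiv (fun _ => F) (1 : Fin (n + 2))).sum_comp, Fintype.sum_prod_type_right]
  refine Finset.sum_eq_zero fun c _ => ?_
  have h0 (a : F) : ∑ b : F, η (a + b) = 0 := by
    rw [← MulChar.sum_eq_zero_of_ne_one hη]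
    exact Equiv.sum_comp (Equiv.addLeft a) η
  have h1 : (1 : Fin (n + 2)).val = 1 := rfl
  simp only [Fin.insertNthEquiv_apply, Fin.sum_univ_succAbove _ (1 : Fin (n + 2)),
    Fin.insertNth_apply_same, Fin.insertNth_apply_succAbove, h1, pow_one, one_pow, mul_zero, mul_one,
    zero_add]
  rw [← Finset.sum_mul]
  have h2 : ∑ b : F, η (1 + (b + ∑ i, c i)) = 0 := by
    rw [← h0 (1 + ∑ i, c i)]
    exact Finset.sum_congr rfl fun b _ => by rw [add_left_comm, add_comm]
  rw [h2, zero_mul]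

theorem monicSum_evalRootsChar {n : ℕ} (hn : Even n) {ζ : F} (hζ : IsPrimitiveRoot ζ (n + 1))
    {χ : MulChar F ℂ} (hχ : orderOf χ = n + 1) {η : MulChar F ℂ} (hη : η ≠ 1) :
    monicSum (evalRootsChar η ζ (n + 1)) n = ∏ j ∈ Finset.range n, jacobiSum (χ ^ (j + 1)) η := by
  obtain ⟨p, hp⟩ := CharP.exists F
  have : Fact p.Prime := ⟨CharP.char_is_prime F p⟩
  have hneg (j : ℕ) : (χ ^ (j + 1)) (-1) = 1 := by
    rw [MulChar.pow_apply' _ j.succ_ne_zero,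
      MulChar.map_neg_one_eq_one_of_odd_pow hn.add_one (hχ ▸ pow_orderOf_eq_one χ), one_pow]
  let E (k : ℕ) := FiniteField.Extension F p (k + 1)
  have (k : ℕ) : Fintype (E k) := Fintype.ofFinite _
  have key := monicSum_card_eq_prod (E := E) (fun k => FiniteField.finrank_extension F p (k + 1))
    (Finset.range n) (evalRootsChar η ζ (n + 1)) (fun j => evalChar η (χ ^ (j + 1)))
    (fun k => by
      rw [powerSum_evalRootsChar η hn.add_one hζ, sum_mulChar_norm_one_sub_pow hζ hχ hη]
      exact Finset.sum_congr rfl fun j _ => (powerSum_evalChar η (hneg j)).symm)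
    fun j _ k hk => monicSum_evalChar_eq_zero hη _ hk
  rw [Finset.card_range] at key
  rw [key]
  exact Finset.prod_congr rfl fun j _ => monicSum_evalChar_one (hneg j)

end JacobiProduct

section HasseDavenport

theorem AddChar.map_sum_eq_prod {A M ι : Type*} [AddCommMonoid A] [CommMonoid M] (φ : AddChar A M)
    (s : Finset ι) (f : ι → A) : φ (∑ i ∈ s, f i) = ∏ i ∈ s, φ (f i) :=
  map_prod φ.toMonoidHom (fun i => Multiplicative.ofAdd (f i)) s

variable {F : Type*} [Field F] {n : ℕ} {ζ : F}

theorem sum_pow_mul_eq_natCast_mul_last (hζ : IsPrimitiveRoot ζ (n + 1)) (c : Fin (n + 1) → F) :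
    ∑ i : Fin (n + 1), ζ ^ (i : ℕ) * ∑ j : Fin (n + 1), (ζ ^ (i : ℕ)) ^ (j : ℕ) * c j =
      ((n + 1 : ℕ) : F) * c (Fin.last n) := by
  have h (j : Fin (n + 1)) : ∑ i : Fin (n + 1), ζ ^ (i : ℕ) * ((ζ ^ (i : ℕ)) ^ (j : ℕ) * c j) =
      (∑ i ∈ Finset.range (n + 1), (ζ ^ ((j : ℕ) + 1)) ^ i) * c j := by
    rw [Finset.sum_range, Finset.sum_mul]
    refine Finset.sum_congr rfl fun i _ => ?_
    ring
  simp only [Finset.mul_sum]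
  rw [Finset.sum_comm]
  simp only [h]
  rw [Fin.sum_univ_castSucc, Finset.sum_eq_zero, zero_add]
  · simp [hζ.pow_eq_one]
  · intro j _
    rw [geom_sum_eq_zero_of_pow_eq_one, zero_mul]
    · rw [← pow_mul, mul_comm, pow_mul, hζ.pow_eq_one, one_pow]
    · exact hζ.pow_ne_one_of_pos_of_lt (Nat.succ_ne_zero _) (by simp)

theorem prod_pow_eq_one_of_even (hn : Even n) (hζ : IsPrimitiveRoot ζ (n + 1)) :
    ∏ i : Fin (n + 1), ζ ^ (i : ℕ) = 1 := by
  obtain ⟨k, rfl⟩ := hn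
  rw [Finset.prod_pow_eq_pow_sum, ← Finset.sum_range fun i => i, Finset.sum_range_id,
    show (k + k + 1) * (k + k + 1 - 1) / 2 = (k + k + 1) * k by
      rw [Nat.add_sub_cancel, ← two_mul, mul_left_comm, Nat.mul_div_cancel_left _ two_pos],
    pow_mul, hζ.pow_eq_one, one_pow]

variable [Fintype F]

theorem sum_prod_mul_addChar_eq_gaussSum_pow (hn : Even n) (hζ : IsPrimitiveRoot ζ (n + 1))
    (η : MulChar F ℂ) (φ : AddChar F ℂ) :
    ∑ c : Fin (n + 1) → F,
      (∏ i : Fin (n + 1), η (∑ j : Fin (n + 1), (ζ ^ (i : ℕ)) ^ (j : ℕ) * c j)) *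
        φ (((n + 1 : ℕ) : F) * c (Fin.last n)) = gaussSum η φ ^ (n + 1) := by
  have hinj : Function.Injective fun i : Fin (n + 1) => ζ ^ (i : ℕ) := fun i j h =>
    Fin.ext (hζ.pow_inj i.2 j.2 h)
  let V := Matrix.vandermonde fun i : Fin (n + 1) => ζ ^ (i : ℕ)
  have hV : Function.Bijective V.mulVec :=
    Finite.injective_iff_bijective.1 <| Matrix.mulVec_injective_of_isUnit <|
      (Matrix.isUnit_iff_isUnit_det _).2 (Matrix.det_vandermonde_ne_zero_iff.2 hinj).isUnit
  have hζ0 : ζ ≠ 0 := hζ.ne_zero (Nat.succ_ne_zero n)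
  calc _ = ∑ v : Fin (n + 1) → F, ∏ i, (η (v i) * φ (ζ ^ (i : ℕ) * v i)) := by
        refine .trans (Finset.sum_congr rfl fun c _ => ?_) (Equiv.sum_comp (.ofBijective _ hV) _)
        rw [Finset.prod_mul_distrib, ← AddChar.map_sum_eq_prod,
          ← sum_pow_mul_eq_natCast_mul_last hζ c]
        rfl
    _ = ∏ i : Fin (n + 1), gaussSum η (φ.mulShift (ζ ^ (i : ℕ))) := by
        simp only [gaussSum, AddChar.mulShift_apply]
        rw [Finset.prod_univ_sum, Fintype.piFinset_univ]
    _ = (∏ i : Fin (n + 1), η (ζ ^ (i : ℕ))) *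
          ∏ i : Fin (n + 1), gaussSum η (φ.mulShift (ζ ^ (i : ℕ))) := by
        rw [← map_prod, prod_pow_eq_one_of_even hn hζ, map_one, one_mul]
    _ = _ := by
        have h (i : Fin (n + 1)) :
            η (ζ ^ (i : ℕ)) * gaussSum η (φ.mulShift (ζ ^ (i : ℕ))) = gaussSum η φ :=
          gaussSum_mulShift η φ (Units.mk0 (ζ ^ (i : ℕ)) (pow_ne_zero _ hζ0))
        simp only [← Finset.prod_mul_distrib, h]
        rw [Finset.prod_const, Finset.card_univ, Fintype.card_fin]

theorem sum_prod_mul_addChar_eq_gaussSum_mul {η : MulChar F ℂ} (hη : η ^ (n + 1) ≠ 1)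
    (ζ : F) (φ : AddChar F ℂ) :
    ∑ c : Fin (n + 1) → F,
      (∏ i : Fin (n + 1), η (∑ j : Fin (n + 1), (ζ ^ (i : ℕ)) ^ (j : ℕ) * c j)) *
        φ (((n + 1 : ℕ) : F) * c (Fin.last n)) =
    gaussSum (η ^ (n + 1)) (φ.mulShift ((n + 1 : ℕ) : F)) *
      monicSum (evalRootsChar η ζ (n + 1)) n := by
  let P (t : F) : ℂ := ∑ c : Fin n → F, ∏ i : Fin (n + 1),
    η (∑ j : Fin n, (ζ ^ (i : ℕ)) ^ (j : ℕ) * c j + (ζ ^ (i : ℕ)) ^ n * t)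
  have hP (u : F) (hu : u ≠ 0) (t : F) : P (u * t) = (η ^ (n + 1)) u * P t := by
    rw [Finset.mul_sum]
    refine .symm <| .trans (Finset.sum_congr rfl fun c _ => ?_)
      (Equiv.sum_comp (Equiv.piCongrRight fun _ => Equiv.mulLeft₀ u hu) _)
    have hpow : (η ^ (n + 1)) u = ∏ _i : Fin (n + 1), η u := by
      rw [MulChar.pow_apply' _ (Nat.succ_ne_zero n), Finset.prod_const, Finset.card_univ,
        Fintype.card_fin]
    rw [hpow, ← Finset.prod_mul_distrib]
    refine Finset.prod_congr rfl fun i _ => ?_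
    rw [← map_mul, mul_add, Finset.mul_sum, mul_left_comm]
    simp only [mul_left_comm u]
    rfl
  have hP0 : P 0 = 0 := by
    obtain ⟨u, hu⟩ := MulChar.ne_one_iff.1 hη
    refine eq_zero_of_mul_eq_self_left hu ?_
    rw [← hP u u.ne_zero, mul_zero]
  have hP1 : P 1 = monicSum (evalRootsChar η ζ (n + 1)) n := by
    refine Finset.sum_congr rfl fun c _ => ?_
    simp only [evalRootsChar_apply, eval_monicOfCoeffs, mul_one, mul_comm, add_comm]
  have hPt (t : F) : P t = (η ^ (n + 1)) t * P 1 := by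
    by_cases ht : t = 0
    · rw [ht, hP0, MulChar.map_zero, zero_mul]
    · rw [← hP t ht, mul_one]
  rw [← Equiv.sum_comp (Fin.snocEquiv fun _ => F), Fintype.sum_prod_type, gaussSum, ← hP1,
    Finset.sum_mul]
  refine Finset.sum_congr rfl fun t _ => ?_
  rw [AddChar.mulShift_apply, mul_right_comm, ← hPt, Finset.sum_mul]
  refine Finset.sum_congr rfl fun c _ => ?_
  simp [Fin.sum_univ_castSucc, Fin.snocEquiv]

theorem gaussSum_pow_mul_prod_jacobiSum (hn : Even n) (hn0 : ((n + 1 : ℕ) : F) ≠ 0)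
    (hζ : IsPrimitiveRoot ζ (n + 1)) {χ : MulChar F ℂ} (hχ : orderOf χ = n + 1) {η : MulChar F ℂ}
    (hη : η ^ (n + 1) ≠ 1) (φ : AddChar F ℂ) :
    gaussSum (η ^ (n + 1)) φ * ∏ j ∈ Finset.range n, jacobiSum (χ ^ (j + 1)) η =
      (η ^ (n + 1)) ((n + 1 : ℕ) : F) * gaussSum η φ ^ (n + 1) := by
  have hη1 : η ≠ 1 := by
    rintro rfl
    exact hη (one_pow _)
  rw [← sum_prod_mul_addChar_eq_gaussSum_pow hn hζ, sum_prod_mul_addChar_eq_gaussSum_mul hη,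
    monicSum_evalRootsChar hn hζ hχ hη1, ← mul_assoc]
  congr 1
  exact (gaussSum_mulShift (η ^ (n + 1)) φ (Units.mk0 _ hn0)).symm

theorem gaussSum_pow_mul_prod_gaussSum_of_pow_ne_one (hn : Even n) (hn0 : ((n + 1 : ℕ) : F) ≠ 0)
    (hζ : IsPrimitiveRoot ζ (n + 1)) {χ : MulChar F ℂ} (hχ : orderOf χ = n + 1) {η : MulChar F ℂ}
    (hη : η ^ (n + 1) ≠ 1) {φ : AddChar F ℂ} (hφ : φ.IsPrimitive) :
    gaussSum (η ^ (n + 1)) φ * ∏ j ∈ Finset.range n, gaussSum (χ ^ (j + 1)) φ =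
      (η ^ (n + 1)) ((n + 1 : ℕ) : F) *
        ∏ j ∈ Finset.range (n + 1), gaussSum (χ ^ j * η) φ := by
  have hη1 : η ≠ 1 := by
    rintro rfl
    exact hη (one_pow _)
  have h (j : ℕ) : χ ^ j * η ≠ 1 := fun h => hη <| by
    rw [eq_inv_of_mul_eq_one_right h, inv_pow, ← pow_mul, mul_comm, pow_mul, ← hχ,
      pow_orderOf_eq_one, one_pow, inv_one]
  have hprod : (∏ j ∈ Finset.range n, gaussSum (χ ^ (j + 1) * η) φ) *
      ∏ j ∈ Finset.range n, jacobiSum (χ ^ (j + 1)) η =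
      (∏ j ∈ Finset.range n, gaussSum (χ ^ (j + 1)) φ) * gaussSum η φ ^ n := by
    have hpow : gaussSum η φ ^ n = ∏ _j ∈ Finset.range n, gaussSum η φ := by
      rw [Finset.prod_const, Finset.card_range]
    rw [hpow, ← Finset.prod_mul_distrib, ← Finset.prod_mul_distrib]
    exact Finset.prod_congr rfl fun j _ => jacobiSum_mul_nontrivial (h _) φ
  have hG : gaussSum η φ ≠ 0 := gaussSum_ne_zero_of_nontrivial (by simp) hη1 hφ
  refine mul_right_cancel₀ (pow_ne_zero n hG) ?_
  rw [mul_assoc, ← hprod, mul_left_comm, gaussSum_pow_mul_prod_jacobiSum hn hn0 hζ hχ hη φ,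
    Finset.prod_range_succ', pow_zero, one_mul]
  ring

end HasseDavenport

section GaussSums

variable {F : Type*} [Field F] [Fintype F]

theorem MulChar.exists_pow_eq_of_pow_orderOf_eq_one {χ η : MulChar F ℂ}
    (h : η ^ orderOf χ = 1) : ∃ i : ℕ, η = χ ^ i := by
  obtain ⟨g, hg⟩ := IsCyclic.exists_generator (α := Fˣ)
  have : NeZero (orderOf χ) := ⟨(MulChar.orderOf_pos χ).ne'⟩
  have hprim : IsPrimitiveRoot (χ g) (orderOf χ) := by
    refine IsPrimitiveRoot.mk_of_lt _ (MulChar.orderOf_pos χ) ?_ fun l hl hlt hone => ?_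
    · rw [← MulChar.pow_apply_coe, pow_orderOf_eq_one, MulChar.one_apply_coe]
    · refine pow_ne_one_of_lt_orderOf hl.ne' hlt ((MulChar.eq_iff hg _ _).2 ?_)
      rw [MulChar.pow_apply_coe, MulChar.one_apply_coe, hone]
  obtain ⟨i, -, hi⟩ := hprim.eq_pow_of_pow_eq_one
    (show η g ^ orderOf χ = 1 by rw [← MulChar.pow_apply_coe, h, MulChar.one_apply_coe])
  exact ⟨i, (MulChar.eq_iff hg _ _).2 (by rw [MulChar.pow_apply_coe, hi])⟩

/-- The **Hasse–Davenport product formula** for an odd number of characters. -/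
theorem gaussSum_pow_mul_prod_gaussSum {n : ℕ} {ζ : F} (hn : Even n)
    (hn0 : ((n + 1 : ℕ) : F) ≠ 0) (hζ : IsPrimitiveRoot ζ (n + 1)) {χ : MulChar F ℂ}
    (hχ : orderOf χ = n + 1) (η : MulChar F ℂ) {φ : AddChar F ℂ} (hφ : φ ≠ 1) :
    gaussSum (η ^ (n + 1)) φ * ∏ j ∈ Finset.range n, gaussSum (χ ^ (j + 1)) φ =
      (η ^ (n + 1)) ((n + 1 : ℕ) : F) *
        ∏ j ∈ Finset.range (n + 1), gaussSum (χ ^ j * η) φ := by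
  by_cases hη : η ^ (n + 1) = 1
  · obtain ⟨i, rfl⟩ := MulChar.exists_pow_eq_of_pow_orderOf_eq_one (hχ ▸ hη)
    have hχ1 : χ ^ (n + 1) = 1 := hχ ▸ pow_orderOf_eq_one χ
    have hshift : ∏ j ∈ Finset.range (n + 1), gaussSum (χ ^ j * χ ^ i) φ =
        ∏ j ∈ Finset.range (n + 1), gaussSum (χ ^ j) φ := by
      induction i with
      | zero => simp only [pow_zero, mul_one]
      | succ i ih =>
        rw [← ih (by rw [← pow_mul, mul_comm, pow_mul, hχ1, one_pow]), Finset.prod_range_succ,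
          Finset.prod_range_succ' fun j => gaussSum (χ ^ j * χ ^ i) φ, pow_succ' χ i, ← mul_assoc,
          ← pow_succ, hχ1, one_mul, pow_zero, one_mul]
        simp only [pow_succ, mul_assoc]
    rw [hη, MulChar.one_apply hn0.isUnit, one_mul, hshift, Finset.prod_range_succ' _ n, pow_zero,
      mul_comm]
  · exact gaussSum_pow_mul_prod_gaussSum_of_pow_ne_one hn hn0 hζ hχ hη
      (AddChar.IsPrimitive.of_ne_one hφ)

theorem gaussSum_ne_zero (χ : MulChar F ℂ) {φ : AddChar F ℂ} (hφ : φ ≠ 1) :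
    gaussSum χ φ ≠ 0 := by
  by_cases h : χ = 1
  · rw [h, gaussSum_one_left hφ]
    exact neg_ne_zero.2 one_ne_zero
  · exact gaussSum_ne_zero_of_nontrivial (by simp) h (AddChar.IsPrimitive.of_ne_one hφ)

theorem gaussSum_mul_gaussSum_inv {χ : MulChar F ℂ} (hχ : χ ≠ 1) {φ : AddChar F ℂ} (hφ : φ ≠ 1) :
    gaussSum χ φ * gaussSum χ⁻¹ φ = χ (-1) * Fintype.card F := by
  have h : χ⁻¹ (-1) = χ (-1) := by
    rw [MulChar.inv_apply', inv_neg, inv_one]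
  rw [← mul_gaussSum_inv_eq_gaussSum χ⁻¹ φ, h, mul_left_comm,
    gaussSum_mul_gaussSum_eq_card hχ (AddChar.IsPrimitive.of_ne_one hφ)]

theorem sum_mulChar_apply [DecidableEq F] (a : F) :
    ∑ η : MulChar F ℂ, η a = if a = 1 then (Fintype.card F : ℂ) - 1 else 0 := by
  split_ifs with h
  · subst h
    simp only [map_one, Finset.sum_const, Finset.card_univ, nsmul_eq_mul, mul_one]
    rw [← Nat.card_eq_fintype_card, MulChar.card_eq_card_units_of_hasEnoughRootsOfUnity,
      Nat.card_eq_fintype_card, Fintype.card_units, Nat.cast_pred Fintype.card_pos]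
  · obtain ⟨χ, hχ⟩ := MulChar.exists_apply_ne_one_of_hasEnoughRootsOfUnity F ℂ h
    refine eq_zero_of_mul_eq_self_left hχ ?_
    simp only [Finset.mul_sum, ← MulChar.mul_apply]
    exact Fintype.sum_bijective _ (Group.mulLeft_bijective χ) _ _ fun _ => rfl

theorem sum_mulChar_mul_jacobiSum_mul_jacobiSum (α β γ : MulChar F ℂ) {a : F} (ha : a ≠ 0) :
    ∑ η : MulChar F ℂ, η a * (jacobiSum (α * η) β * jacobiSum η⁻¹ γ) =
      ((Fintype.card F : ℂ) - 1) * ∑ x : F, α x * β (1 - x) * γ (1 - a * x) := by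
  classical
  have h (η : MulChar F ℂ) : η a * (jacobiSum (α * η) β * jacobiSum η⁻¹ γ) =
      ∑ x : F, ∑ y : F, α x * β (1 - x) * γ (1 - y) * η (a * x * y⁻¹) := by
    rw [jacobiSum, jacobiSum, Finset.sum_mul_sum, Finset.mul_sum]
    refine Finset.sum_congr rfl fun x _ => ?_
    rw [Finset.mul_sum]
    refine Finset.sum_congr rfl fun y _ => ?_
    rw [MulChar.mul_apply, MulChar.inv_apply', map_mul, map_mul]
    ring
  simp only [h]
  rw [Finset.sum_comm, Finset.mul_sum]
  refine Finset.sum_congr rfl fun x _ => ?_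
  rw [Finset.sum_comm]
  simp only [← Finset.mul_sum, sum_mulChar_apply]
  by_cases hx : x = 0
  · simp [hx, MulChar.map_zero]
  rw [Finset.sum_eq_single (a * x)]
  · rw [if_pos (mul_inv_cancel₀ (mul_ne_zero ha hx)), mul_comm]
  · intro y _ hy
    rw [if_neg, mul_zero]
    intro h1
    exact hy (eq_of_mul_inv_eq_one h1).symm
  · simp

end GaussSums

section Quintic

variable {F : Type*} [Field F] [Fintype F] {χ : MulChar F ℂ}

theorem gaussSum'_eq_gaussSum (φ : AddChar F ℂ) (χ : MulChar F ℂ) :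
    gaussSum' φ χ = gaussSum χ φ := by
  classical
  refine Finset.sum_of_injOn Units.val Units.val_injective.injOn (by simp) (fun x _ hx => ?_)
    fun x _ => mul_comm _ _
  rw [χ.map_nonunit fun ⟨u, hu⟩ => hx ⟨u, by simp, hu⟩, zero_mul]

theorem gaussSum_mul_jacobiSum_mul_jacobiSum {χ η : MulChar F ℂ} (hχ : orderOf χ = 5)
    (hη : η ≠ 1) {φ : AddChar F ℂ} (hφ : φ ≠ 1) :
    gaussSum η φ ^ 2 * (jacobiSum (χ ^ 2 * η) (χ ^ 3) * jacobiSum η⁻¹ (χ ^ 2)) =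
      Fintype.card F * (gaussSum (χ ^ 2 * η) φ * gaussSum (χ ^ 3 * η) φ) := by
  have h5 : χ ^ 5 = 1 := hχ ▸ pow_orderOf_eq_one χ
  have hneg : χ (-1) = 1 := MulChar.map_neg_one_eq_one_of_odd_pow (by decide : Odd 5) h5
  have h2 : χ ^ 2 ≠ 1 := pow_ne_one_of_lt_orderOf two_ne_zero (by simp [hχ])
  have hinv : (χ ^ 2)⁻¹ = χ ^ 3 := inv_eq_of_mul_eq_one_right (by rw [← pow_add, h5])
  have hG : gaussSum (χ ^ 2) φ * gaussSum (χ ^ 3) φ = Fintype.card F := by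
    rw [← hinv, gaussSum_mul_gaussSum_inv h2 hφ, MulChar.pow_apply' _ two_ne_zero, hneg, one_pow,
      one_mul]
  have hprod : χ ^ 2 * η * χ ^ 3 = η := by
    rw [mul_right_comm, ← pow_add, h5, one_mul]
  have hJ := jacobiSum_mul_nontrivial (hprod.symm ▸ hη) φ
  rw [hprod] at hJ
  by_cases hη2 : η = χ ^ 2
  · have hχη : χ ^ 3 * η = 1 := by rw [hη2, ← pow_add, h5]
    have hJ' : jacobiSum η⁻¹ (χ ^ 2) = -1 := by
      rw [jacobiSum_comm, hη2, jacobiSum_nontrivial_inv h2, MulChar.pow_apply' _ two_ne_zero, hneg,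
        one_pow]
    rw [hχη, gaussSum_one_left hφ, hJ', ← hG]
    subst hη2
    linear_combination (-gaussSum (χ ^ 2) φ) * hJ
  · have h3 : χ ^ 3 * η ≠ 1 := by
      intro h
      rw [eq_inv_of_mul_eq_one_right h, ← hinv, inv_inv] at hη2
      exact hη2 rfl
    have hinv' : η⁻¹ * χ ^ 2 = (χ ^ 3 * η)⁻¹ := by
      rw [mul_inv, ← hinv, inv_inv, mul_comm]
    have hJ' := jacobiSum_mul_nontrivial (χ := η⁻¹) (φ := χ ^ 2)
      (by rw [hinv']; exact inv_ne_one.2 h3) φ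
    have hGη := gaussSum_mul_gaussSum_inv hη hφ
    have hGη3 := gaussSum_mul_gaussSum_inv h3 hφ
    rw [MulChar.mul_apply, MulChar.pow_apply' _ three_ne_zero, hneg, one_pow, one_mul, ← hGη,
      ← hinv'] at hGη3
    refine mul_left_cancel₀ (gaussSum_ne_zero (η⁻¹ * χ ^ 2) hφ) ?_
    rw [← hG]
    linear_combination (gaussSum η φ * gaussSum (η⁻¹ * χ ^ 2) φ * jacobiSum η⁻¹ (χ ^ 2)) * hJ +
      gaussSum η φ * gaussSum (χ ^ 2 * η) φ * gaussSum (χ ^ 3) φ * hJ' -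
      gaussSum (χ ^ 2) φ * gaussSum (χ ^ 3) φ * gaussSum (χ ^ 2 * η) φ * hGη3

theorem gaussSum_pow_five_mul (hchar : ringChar F ≠ 5) (hq : Fintype.card F % 5 = 1)
    (hχ : orderOf χ = 5) (η : MulChar F ℂ) {φ : AddChar F ℂ} (hφ : φ ≠ 1) :
    gaussSum (η ^ 5) φ * (Fintype.card F : ℂ) ^ 2 = η 5 ^ 5 *
      (gaussSum η φ * gaussSum (χ * η) φ * gaussSum (χ ^ 2 * η) φ * gaussSum (χ ^ 3 * η) φ *
        gaussSum (χ ^ 4 * η) φ) := by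
  classical
  have h5 : χ ^ 5 = 1 := hχ ▸ pow_orderOf_eq_one χ
  have hneg : χ (-1) = 1 := MulChar.map_neg_one_eq_one_of_odd_pow (by decide : Odd 5) h5
  have hF : ((4 + 1 : ℕ) : F) ≠ 0 := by
    intro h
    have h' := (ringChar.spec F 5).1 h
    exact hchar ((Nat.prime_dvd_prime_iff_eq (CharP.char_is_prime F _) Nat.prime_five).1 h')
  obtain ⟨ζ, hζ⟩ : ∃ ζ : F, IsPrimitiveRoot ζ 5 := by
    have : Fact (Nat.Prime 5) := ⟨Nat.prime_five⟩
    obtain ⟨u, hu⟩ := exists_prime_orderOf_dvd_card (G := Fˣ) 5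
      (by rw [Fintype.card_units]; omega)
    exact ⟨u, IsPrimitiveRoot.coe_units_iff.2 (hu ▸ IsPrimitiveRoot.orderOf u)⟩
  have hG {j k : ℕ} (hjk : j + k = 5) (hj : 0 < j) (hk : 0 < k) :
      gaussSum (χ ^ j) φ * gaussSum (χ ^ k) φ = Fintype.card F := by
    have hinv : (χ ^ j)⁻¹ = χ ^ k := inv_eq_of_mul_eq_one_right (by rw [← pow_add, hjk, h5])
    rw [← hinv, gaussSum_mul_gaussSum_inv
      (pow_ne_one_of_lt_orderOf hj.ne' (by omega)) hφ, MulChar.pow_apply' _ hj.ne', hneg, one_pow,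
      one_mul]
  have key := gaussSum_pow_mul_prod_gaussSum (by decide : Even 4) hF hζ hχ η hφ
  simp only [Finset.prod_range_succ, Finset.prod_range_zero, pow_zero, one_mul] at key
  rw [MulChar.pow_apply' _ (by norm_num)] at key
  norm_num at key
  rw [← key]
  have h14 := hG (j := 1) (k := 4) rfl (by norm_num) (by norm_num)
  have h23 := hG (j := 2) (k := 3) rfl (by norm_num) (by norm_num)
  rw [pow_one] at h14
  rw [sq]
  nth_rw 1 [← h14]
  rw [← h23]
  ring

theorem zNum_eq (s : Fin 5 → ℤ) [DecidableEq (MulChar F ℂ)] (χ η : MulChar F ℂ) :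
    zNum χ η s = ∑ j : Fin 5, if χ ^ s j * η = 1 then 1 else 0 := by
  rw [zNum, Finset.card_filter]
  congr!

theorem zNum_one (hχ : orderOf χ = 5) : zNum χ 1 ![0, 0, 0, 1, 4] = 3 := by
  classical
  have h1 : χ ≠ 1 := fun h => by simp [h] at hχ
  have h4 : χ ^ 4 ≠ 1 := pow_ne_one_of_lt_orderOf four_ne_zero (by omega)
  rw [zNum_eq, Fin.sum_univ_five]
  simp [h1, h4]

theorem zNum_add_deltaNum (hχ : orderOf χ = 5) {η : MulChar F ℂ} (hη : η ≠ 1) :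
    zNum χ η ![0, 0, 0, 1, 4] + deltaNum χ η ![0, 0, 0, 1, 4] = 1 := by
  classical
  have h3 : χ ^ 3 ≠ 1 := pow_ne_one_of_lt_orderOf three_ne_zero (by omega)
  rw [deltaNum, zNum_eq, Fin.sum_univ_five]
  by_cases h1 : χ * η = 1
  · have h4 : χ ^ 4 * η ≠ 1 := by
      rwa [pow_succ, mul_assoc, h1, mul_one]
    simp [hη, h1, h4]
  · by_cases h4 : χ ^ 4 * η = 1 <;> simp [hη, h1, h4]

theorem NcurvePsi_two_three (h5 : χ ^ 5 = 1) {a : F} (ha : a ≠ 0) :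
    NcurvePsi 2 3 a χ = ∑ x : F, (χ ^ 2) x * (χ ^ 3) (1 - x) * (χ ^ 2) (1 - a * x) := by
  classical
  have h : χ ^ (-((3 : ℕ) : ℤ)) = χ ^ 2 := by
    rw [zpow_neg, zpow_natCast]
    exact inv_eq_of_mul_eq_one_right (by rw [← pow_add, h5])
  rw [NcurvePsi, h]
  refine Finset.sum_subset (Finset.filter_subset _ _) fun x _ hx => ?_
  rw [Finset.mem_filter, not_and] at hx
  by_cases h0 : x = 0
  · simp [h0, MulChar.map_zero]
  by_cases h1 : x = 1
  · simp [h1, MulChar.map_zero]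
  have h2 : x = a⁻¹ := by
    by_contra h2
    exact hx (Finset.mem_univ x) ⟨h0, h1, h2⟩
  simp [h2, ha, MulChar.map_zero]

theorem Ntuple_eq_card_mul_NcurvePsi (hchar : ringChar F ≠ 5) (hq : Fintype.card F % 5 = 1)
    {ψ : F} (hψ : ψ ≠ 0) {φ : AddChar F ℂ} (hφ : φ ≠ 1) (hχ : orderOf χ = 5) :
    Ntuple φ χ ψ ![0, 0, 0, 1, 4] =
      (Fintype.card F : ℂ) * NcurvePsi 2 3 ((ψ ^ 5)⁻¹) χ := by
  have h5 : χ ^ 5 = 1 := hχ ▸ pow_orderOf_eq_one χ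
  have hF : (5 : F) ≠ 0 := by
    intro h
    have h' := (ringChar.spec F 5).1 (by exact_mod_cast h)
    exact hchar ((Nat.prime_dvd_prime_iff_eq (CharP.char_is_prime F _) Nat.prime_five).1 h')
  have hq0 : (Fintype.card F : ℂ) ≠ 0 := by simp
  have hq1 : (Fintype.card F : ℂ) - 1 ≠ 0 :=
    sub_ne_zero.2 (by exact_mod_cast Fintype.one_lt_card.ne')
  have hlam : (ψ ^ 5)⁻¹ ≠ 0 := inv_ne_zero (pow_ne_zero 5 hψ)
  rw [NcurvePsi_two_three h5 hlam, Ntuple, one_div, inv_mul_eq_iff_eq_mul₀ hq1, mul_left_comm,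
    ← sum_mulChar_mul_jacobiSum_mul_jacobiSum _ _ _ hlam, Finset.mul_sum]
  refine Finset.sum_congr rfl fun η _ => ?_
  have hη5 : η ((((5 : F) * ψ) ^ 5)⁻¹) = (η 5 ^ 5)⁻¹ * η (ψ ^ 5)⁻¹ := by
    rw [mul_pow, mul_inv, map_mul, ← MulChar.inv_apply', MulChar.inv_apply_eq_inv', map_pow]
  have hη50 : η 5 ≠ 0 := (hF.isUnit.map η).ne_zero
  have key := gaussSum_pow_five_mul hchar hq hχ η hφ
  have hprod : ∏ j : Fin 5, gaussSum' φ (χ ^ (![0, 0, 0, 1, 4] : Fin 5 → ℤ) j * η) =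
      gaussSum η φ ^ 3 * gaussSum (χ * η) φ * gaussSum (χ ^ 4 * η) φ := by
    rw [Fin.prod_univ_five]
    simp only [gaussSum'_eq_gaussSum]
    simp only [Matrix.cons_val, zpow_ofNat, pow_zero, pow_one, one_mul]
    ring
  have hJ : (Fintype.card F : ℂ) ^ ((5 : ℤ) - zNum χ η ![0, 0, 0, 1, 4] -
      deltaNum χ η ![0, 0, 0, 1, 4]) * (gaussSum (χ ^ 2 * η) φ * gaussSum (χ ^ 3 * η) φ) =
      (Fintype.card F : ℂ) ^ 3 * gaussSum η φ ^ 2 *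
        (jacobiSum (χ ^ 2 * η) (χ ^ 3) * jacobiSum η⁻¹ (χ ^ 2)) := by
    by_cases hη : η = 1
    · subst hη
      have hd : deltaNum χ 1 ![0, 0, 0, 1, 4] = 0 := by
        rw [deltaNum, zNum_one hχ]
        rfl
      have h2 : χ ^ 2 ≠ 1 := pow_ne_one_of_lt_orderOf two_ne_zero (by omega)
      have hneg : (χ ^ 2) (-1) = 1 :=
        MulChar.map_neg_one_eq_one_of_odd_pow (by decide : Odd 5)
          (by rw [← pow_mul, mul_comm, pow_mul, h5, one_pow])
      have hinv : χ ^ 3 = (χ ^ 2)⁻¹ := eq_inv_of_mul_eq_one_right (by rw [← pow_add, h5])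
      rw [zNum_one hχ, hd, inv_one, mul_one, mul_one, jacobiSum_one_nontrivial h2, hinv,
        jacobiSum_nontrivial_inv h2, gaussSum_mul_gaussSum_inv h2 hφ, hneg, gaussSum_one_left hφ]
      norm_num
      norm_cast
    · have hz : (5 : ℤ) - zNum χ η ![0, 0, 0, 1, 4] - deltaNum χ η ![0, 0, 0, 1, 4] = (4 : ℕ) := by
        have := zNum_add_deltaNum hχ hη
        omega
      rw [hz, zpow_natCast, mul_assoc, gaussSum_mul_jacobiSum_mul_jacobiSum hχ hη hφ]
      ring
  have hG (α : MulChar F ℂ) := gaussSum_ne_zero α hφ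
  rw [hprod, gaussSum'_eq_gaussSum, hη5]
  have h0 := hG η
  have h1 := hG (χ * η)
  have h4 := hG (χ ^ 4 * η)
  generalize (Fintype.card F : ℂ) ^ ((5 : ℤ) - zNum χ η ![0, 0, 0, 1, 4] -
    deltaNum χ η ![0, 0, 0, 1, 4]) = Q at hJ ⊢
  field_simp
  refine mul_left_cancel₀ (pow_ne_zero 2 hq0) ?_
  linear_combination (Q * η (1 / ψ ^ 5)) * key +
    (η 5 ^ 5 * gaussSum η φ * gaussSum (χ * η) φ * gaussSum (χ ^ 4 * η) φ * η (1 / ψ ^ 5)) * hJ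

end Quintic

end

/-- Let `F` be a finite field with `q ≡ 1 (mod 5)` elements of
characteristic `p ≠ 5`, let `ψ ∈ F*`, set `λ = ψ⁻⁵`, and let `χ` be a multiplicative
character of `F` of order `5`. With
`N(A_ψ, χ') = ∑_{x ≠ 0, 1, 1/λ} χ'²(x) χ'³(1-x) χ'⁻³(1-λx)`, we have
`N_{(0,0,0,1,4),χ}(q) = q N(A_ψ, χ)` and `N_{(0,0,0,2,3),χ}(q) = q N(A_ψ, χ²)`. -/
theorem stmt_17 {F : Type*} [Field F] [Fintype F] (hchar : ringChar F ≠ 5)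
    (hq : Fintype.card F % 5 = 1) (ψ : F) (hψ : ψ ≠ 0)
    (φ : AddChar F ℂ) (hφ : φ ≠ 1) (χ : MulChar F ℂ) (hχ : orderOf χ = 5) :
    Ntuple φ χ ψ ![0, 0, 0, 1, 4] =
        (Fintype.card F : ℂ) * NcurvePsi 2 3 ((ψ ^ 5)⁻¹) χ ∧
      Ntuple φ χ ψ ![0, 0, 0, 2, 3] =
        (Fintype.card F : ℂ) * NcurvePsi 2 3 ((ψ ^ 5)⁻¹) (χ ^ 2) := by
  refine ⟨Ntuple_eq_card_mul_NcurvePsi hchar hq hψ hφ hχ, ?_⟩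
  have hχ2 : orderOf (χ ^ 2) = 5 := by
    rw [orderOf_pow, hχ]
    rfl
  rw [← Ntuple_eq_card_mul_NcurvePsi hchar hq hψ hφ hχ2]
  have hpow (j : Fin 5) : χ ^ (![0, 0, 0, 2, 3] : Fin 5 → ℤ) j =
      (χ ^ 2) ^ (![0, 0, 0, 1, 4] : Fin 5 → ℤ) j := by
    have h8 : (χ ^ 2) ^ 4 = χ ^ 3 := by
      rw [← pow_mul, show 2 * 4 = 5 + 3 from rfl, pow_add, ← hχ, pow_orderOf_eq_one, one_mul]
    fin_cases j
    · simp
    · simp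
    · simp
    · simp [zpow_ofNat]
    · simp [zpow_ofNat, h8]
  have hz (η : MulChar F ℂ) : zNum χ η ![0, 0, 0, 2, 3] = zNum (χ ^ 2) η ![0, 0, 0, 1, 4] := by
    classical
    simp only [zNum_eq, hpow]
  simp only [Ntuple, deltaNum, hz, hpow]
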